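/- Let h be an integer and k an odd positive integer with gcd(h,k) = 1. Then the Jacobi symbol satisfies (h/k) = (−1)^{((k−1)/2 − 6k·s(h,k))/2}. -/

import Mathlib

/-- The sawtooth function ((y)) : y - ⌊y⌋ - 1/2 if y ∉ ℤ, and 0 if y ∈ ℤ. -/
noncomputable def sawtooth (y : ℚ) : ℚ := if y.den = 1 then 0 else y - ⌊y⌋ - 1/2

/-- The Dedekind sum s(h,k) = Σ_{m=1}^{k} ((hm/k))((m/k)). -/
noncomputable def dedekindS (h : ℤ) (k : ℕ) : ℚ :=
  ∑ m ∈ Finset.Icc 1 k, sawtooth ((h * m : ℤ) / (k : ℚ)) * sawtooth ((m : ℚ) / (k : ℚ))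

def dF (h : ℤ) (k : ℕ) : ℤ := ∑ m ∈ Finset.range k, (m:ℤ) * (h * m / k)
def dA (h : ℤ) (k : ℕ) : ℤ := 2*h*(k-1)*(2*k-1) - 12 * dF h k - 3*k*(k-1)

lemma sum1 (k : ℕ) : 2 * ∑ m ∈ Finset.range k, (m:ℤ) = k*(k-1) := by
  induction k with
  | zero => simp
  | succ n ih => rw [Finset.sum_range_succ, mul_add, ih]; push_cast; ring

lemma sum2 (k : ℕ) : 6 * ∑ m ∈ Finset.range k, (m:ℤ)^2 = k*(k-1)*(2*k-1) := by
  induction k with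
  | zero => simp
  | succ n ih => rw [Finset.sum_range_succ, mul_add, ih]; push_cast; ring

lemma perm_sum (h : ℤ) (k : ℕ) (hk : 0 < k) (hc : IsCoprime h (k:ℤ)) (g : ℤ → ℤ) :
    ∑ m ∈ Finset.range k, g (h * m % k) = ∑ m ∈ Finset.range k, g m := by
  have hk' : (0:ℤ) < k := by exact_mod_cast hk
  have hmap : ∀ m ∈ Finset.range k, (h * m % k).toNat ∈ Finset.range k := by
    intro m _
    have h1 := Int.emod_nonneg (h*m) hk'.ne'
    have h2 := Int.emod_lt_of_pos (h*m) hk'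
    rw [Finset.mem_range]; omega
  have hinj : Set.InjOn (fun m : ℕ => (h * m % k).toNat) (Finset.range k) := by
    intro a ha b hb hab
    simp only [Finset.coe_range, Set.mem_Iio] at ha hb hab
    have h1 := Int.emod_nonneg (h*a) hk'.ne'
    have h2 := Int.emod_nonneg (h*b) hk'.ne'
    have h3 : h*a % k = h*b % k := by omega
    have h4 : (k:ℤ) ∣ h * (a - b) := by
      rw [mul_sub]; exact Int.ModEq.dvd (Eq.symm h3)
    have h5 : (k:ℤ) ∣ a - b := hc.symm.dvd_of_dvd_mul_left h4
    have := Int.eq_zero_of_abs_lt_dvd h5 (by rw [abs_lt]; omega)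
    omega
  have himg : (Finset.range k).image (fun m : ℕ => (h * m % k).toNat) = Finset.range k := by
    apply Finset.eq_of_subset_of_card_le
    · intro x hx
      obtain ⟨m, hm, rfl⟩ := Finset.mem_image.1 hx
      exact hmap m hm
    · rw [Finset.card_image_of_injOn hinj]
  conv_rhs => rw [← himg, Finset.sum_image hinj]
  apply Finset.sum_congr rfl
  intro m _
  rw [Int.toNat_of_nonneg (Int.emod_nonneg _ hk'.ne')]

lemma sum_f (h : ℤ) (k : ℕ) (hk : 0 < k) (hc : IsCoprime h (k:ℤ)) :
    2 * ∑ m ∈ Finset.range k, (h * m / k) = (h-1)*(k-1) := by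
  have hk' : (k:ℤ) ≠ 0 := by exact_mod_cast hk.ne'
  have h1 := perm_sum h k hk hc (fun x => x)
  have h2 := sum1 k
  simp only [Int.emod_def, Finset.sum_sub_distrib, ← Finset.mul_sum] at h1
  apply mul_left_cancel₀ hk'
  linear_combination -2*h1 + (h-1)*h2

lemma sum_g (h : ℤ) (k : ℕ) (hk : 0 < k) (hc : IsCoprime h (k:ℤ)) :
    k^2 * ∑ m ∈ Finset.range k, (h * m / k)^2 + (h^2-1) * ∑ m ∈ Finset.range k, (m:ℤ)^2
      = 2*h*k*dF h k := by
  have h1 := perm_sum h k hk hc (fun x => x^2)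
  have : ∀ m ∈ Finset.range k, (h*m%k)^2 = h^2 * (m:ℤ)^2 - 2*h*k*(m * (h*m/k)) + k^2*(h*m/k)^2 := by
    intro m _; rw [Int.emod_def]; ring
  rw [Finset.sum_congr rfl this] at h1
  simp only [Finset.sum_add_distrib, Finset.sum_sub_distrib, ← Finset.mul_sum] at h1
  unfold dF
  linear_combination h1

lemma gsum (n a : ℕ) (ha : a < n) :
    ∑ j ∈ Finset.range n, (if j ≤ a then 2*(j:ℤ) else 0) = a^2 + a := by
  rw [← Finset.sum_filter]
  have : (Finset.range n).filter (· ≤ a) = Finset.range (a+1) := by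
    ext; simp; omega
  rw [this, ← Finset.mul_sum, sum1]; push_cast; ring

lemma csum (n a : ℕ) (ha : a < n) :
    ∑ j ∈ Finset.range n, (if a < j then (1:ℤ) else 0) = n - 1 - a := by
  rw [← Finset.sum_filter]
  have : (Finset.range n).filter (a < ·) = Finset.Ico (a+1) n := by
    ext; simp; omega
  rw [this]; simp; omega

lemma lattice (h k : ℕ) (hh : 0 < h) (hk : 0 < k) (hc : Nat.Coprime h k) :
    ∑ m ∈ Finset.range k, (((h:ℤ) * m / k)^2 + (h:ℤ) * m / k) =
      (k-1)*h*(h-1) - 2 * dF k h := by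
  have e1 : ∀ m ∈ Finset.range k, (((h:ℤ) * m / k)^2 + (h:ℤ) * m / k) =
      ∑ j ∈ Finset.range h, (if j * k ≤ h * m then 2*(j:ℤ) else 0) := by
    intro m hm
    rw [Finset.mem_range] at hm
    have hlt : h*m/k < h := by
      rw [Nat.div_lt_iff_lt_mul hk]; exact Nat.mul_lt_mul_of_pos_left hm hh
    have := gsum h (h*m/k) hlt
    simp only [Nat.le_div_iff_mul_le hk] at this
    rw [this]; push_cast; rfl
  rw [Finset.sum_congr rfl e1, Finset.sum_comm]
  have e2 : ∀ j ∈ Finset.range h, ∑ m ∈ Finset.range k, (if j * k ≤ h * m then 2*(j:ℤ) else 0)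
      = 2 * (k-1) * j - 2 * (j * ((k:ℤ) * j / h)) := by
    intro j hj
    rw [Finset.mem_range] at hj
    rcases Nat.eq_zero_or_pos j with rfl | hj0
    · simp
    have hlt : k*j/h < k := by
      rw [Nat.div_lt_iff_lt_mul hh]; exact Nat.mul_lt_mul_of_pos_left hj hk
    have := csum k (k*j/h) hlt
    have e3 : ∀ m ∈ Finset.range k, (if j * k ≤ h * m then 2*(j:ℤ) else 0) =
        2 * j * (if k*j/h < m then (1:ℤ) else 0) := by
      intro m _
      have : j * k ≤ h * m ↔ k*j/h < m := by
        rw [Nat.div_lt_iff_lt_mul hh, mul_comm j k, mul_comm h m]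
        constructor
        · intro hle
          apply lt_of_le_of_ne hle
          intro heq
          have : h ∣ k * j := ⟨m, by rw [heq, mul_comm]⟩
          have := Nat.le_of_dvd hj0 (hc.dvd_of_dvd_mul_left this)
          omega
        · exact le_of_lt
      simp [this]
    rw [Finset.sum_congr rfl e3, ← Finset.mul_sum, this]; push_cast; ring
  rw [Finset.sum_congr rfl e2, Finset.sum_sub_distrib, ← Finset.mul_sum, ← Finset.mul_sum]
  unfold dF
  linear_combination (k-1:ℤ) * sum1 h

lemma recip (h k : ℕ) (hh : 0 < h) (hk : 0 < k) (hc : Nat.Coprime h k) :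
    (h:ℤ) * dA h k + k * dA k h = h^2+k^2+1-3*h*k := by
  have hc' : IsCoprime (h:ℤ) (k:ℤ) := Nat.isCoprime_iff_coprime.2 hc
  have hk' : (k:ℤ) ≠ 0 := by exact_mod_cast hk.ne'
  have a1 := sum_f h k hk hc'
  have a2 := sum_g h k hk hc'
  have a3 := lattice h k hh hk hc
  rw [Finset.sum_add_distrib] at a3
  have a4 := sum2 k
  apply mul_left_cancel₀ hk'
  unfold dA
  linear_combination 6*a2 - 6*(k:ℤ)^2*a3 + 3*(k:ℤ)^2*a1 - (h^2-1:ℤ)*a4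

lemma dA_add (h c : ℤ) (k : ℕ) (hk : 0 < k) : dA (h + c*k) k = dA h k := by
  have hk' : (k:ℤ) ≠ 0 := by exact_mod_cast hk.ne'
  have : dF (h+c*k) k = dF h k + c * ∑ m ∈ Finset.range k, (m:ℤ)^2 := by
    unfold dF
    rw [Finset.mul_sum, ← Finset.sum_add_distrib]
    apply Finset.sum_congr rfl
    intro m _
    rw [show (h+c*k)*m = h*m + (c*m)*k by ring, Int.add_mul_ediv_right _ _ hk']; ring
  unfold dA
  rw [this]
  linear_combination (-2*c)*sum2 k

lemma ndvd (h : ℤ) (k m : ℕ) (hc : IsCoprime h (k:ℤ)) (h0 : 0 < m) (h1 : m < k) :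
    ¬ (k:ℤ) ∣ h * m := by
  intro hd
  have := Int.le_of_dvd (by omega) (hc.symm.dvd_of_dvd_mul_left hd)
  omega

lemma dA_neg (h : ℤ) (k : ℕ) (hk : 0 < k) (hc : IsCoprime h (k:ℤ)) : dA (-h) k = - dA h k := by
  have hk' : (0:ℤ) < k := by exact_mod_cast hk
  have : dF (-h) k = - dF h k - ∑ m ∈ Finset.range k, (m:ℤ) := by
    unfold dF
    rw [← Finset.sum_neg_distrib, ← Finset.sum_sub_distrib]
    apply Finset.sum_congr rfl
    intro m hm
    rw [Finset.mem_range] at hm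
    rcases Nat.eq_zero_or_pos m with rfl | h0
    · simp
    have hd := ndvd h k m hc h0 hm
    have h2 : (-h * m)/k = -(h*m/k) - 1 := by
      have b1 := Int.mul_ediv_add_emod (h*m) k
      have b2 := Int.emod_lt_of_pos (h*m) hk'
      have b3 := Int.emod_nonneg (h*m) hk'.ne'
      have b4 : h*m % k ≠ 0 := fun h => hd (Int.dvd_of_emod_eq_zero h)
      rw [Int.ediv_eq_iff_of_pos hk']
      constructor
      · linarith
      · have : 0 < h*m%k := by omega
        linarith
    rw [h2]; ring
  unfold dA
  rw [this]
  linear_combination 6*sum1 k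

lemma key8 : ∀ h k A : ZMod 8, ((k = 1 ∨ k = 5) ∧ (h = 1 ∨ h = 3 ∨ h = 5 ∨ h = 7)  ∨
    (h = 1 ∨ h = 5) ∧ (k = 1 ∨ k = 3 ∨ k = 5 ∨ k = 7)) →
    (h * A + k * (h+1-2) = h^2+k^2+1-3*h*k → A = k+1-2) ∧ 
    (h * A + k * (h+1+2) = h^2+k^2+1-3*h*k → A = k+1+2) := by decide
lemma key8' : ∀ h k A : ZMod 8, ((k = 3 ∨ k = 7) ∧ (h = 3 ∨ h = 7)) →
    (h * A + k * (h+1-2) = h^2+k^2+1-3*h*k → A = k+1+2) ∧ 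
    (h * A + k * (h+1+2) = h^2+k^2+1-3*h*k → A = k+1-2) := by decide

lemma modcast (n : ℕ) : (n : ZMod 8) = ((n % 8 : ℕ) : ZMod 8) := by simp

lemma step (h k : ℕ) (hh : Odd h) (hk : Odd k) (hc : Nat.Coprime h k)
    (ih : (dA k h : ZMod 8) = h + 1 - 2 * (jacobiSym k h : ℤ)) :
    (dA h k : ZMod 8) = k + 1 - 2 * (jacobiSym h k : ℤ) := by
  have r := congrArg (fun x : ℤ => (x : ZMod 8)) (recip h k hh.pos hk.pos hc)
  push_cast at r
  rw [ih] at r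
  have hj : jacobiSym k h = 1 ∨ jacobiSym k h = -1 :=
    jacobiSym.eq_one_or_neg_one (by simpa [Int.gcd_natCast_natCast] using hc.symm)
  have oh : h % 8 = 1 ∨ h % 8 = 3 ∨ h % 8 = 5 ∨ h % 8 = 7 := by
    rw [Nat.odd_iff] at hh; omega
  have ok : k % 8 = 1 ∨ k % 8 = 3 ∨ k % 8 = 5 ∨ k % 8 = 7 := by
    rw [Nat.odd_iff] at hk; omega
  have ch : (h : ZMod 8) = 1 ∨ (h : ZMod 8) = 3 ∨ (h : ZMod 8) = 5 ∨ (h : ZMod 8) = 7 := by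
    rw [modcast]; rcases oh with e | e | e | e <;> rw [e] <;> decide
  have ck : (k : ZMod 8) = 1 ∨ (k : ZMod 8) = 3 ∨ (k : ZMod 8) = 5 ∨ (k : ZMod 8) = 7 := by
    rw [modcast]; rcases ok with e | e | e | e <;> rw [e] <;> decide
  by_cases k1 : k % 4 = 1
  · have e := jacobiSym.quadratic_reciprocity_one_mod_four' hh k1
    have ck' : (k : ZMod 8) = 1 ∨ (k : ZMod 8) = 5 := by
      rw [modcast]
      have : k % 8 = 1 ∨ k % 8 = 5 := by omega
      rcases this with e | e <;> rw [e] <;> decide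
    have K := key8 h k (dA h k : ℤ) (Or.inl ⟨ck', ch⟩)
    rw [e]
    rcases hj with j | j <;> rw [j] at r ⊢
    · simpa using K.1 (by simpa using r)
    · simpa [sub_neg_eq_add] using K.2 (by simpa using r)
  by_cases h1 : h % 4 = 1
  · have e := jacobiSym.quadratic_reciprocity_one_mod_four h1 hk
    have ck' : (h : ZMod 8) = 1 ∨ (h : ZMod 8) = 5 := by
      rw [modcast]
      have : h % 8 = 1 ∨ h % 8 = 5 := by omega
      rcases this with e | e <;> rw [e] <;> decide
    have K := key8 h k (dA h k : ℤ) (Or.inr ⟨ck', ck⟩)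
    rw [e]
    rcases hj with j | j <;> rw [j] at r ⊢
    · simpa using K.1 (by simpa using r)
    · simpa using K.2 (by simpa using r)
  have h3 : h % 4 = 3 := by omega
  have k3 : k % 4 = 3 := by omega
  have e := jacobiSym.quadratic_reciprocity_three_mod_four h3 k3
  have ck' : (h : ZMod 8) = 3 ∨ (h : ZMod 8) = 7 := by
      rw [modcast]
      have : h % 8 = 3 ∨ h % 8 = 7 := by omega
      rcases this with e | e <;> rw [e] <;> decide
  have ck'' : (k : ZMod 8) = 3 ∨ (k : ZMod 8) = 7 := by
      rw [modcast]
      have : k % 8 = 3 ∨ k % 8 = 7 := by omega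
      rcases this with e | e <;> rw [e] <;> decide
  have K := key8' h k (dA h k : ℤ) ⟨ck'', ck'⟩
  rw [e]
  rcases hj with j | j <;> rw [j] at r ⊢
  · simpa using K.1 (by simpa using r)
  · simpa using K.2 (by simpa using r)

lemma key_neg (k A : ZMod 8) (J : ℤ) (n : ℕ) (hn : Odd n) (hJ : J = 1 ∨ J = -1) (e : (n : ZMod 8) = k)
    (hA : A = k + 1 - 2 * ((ZMod.χ₄ n * J : ℤ) : ZMod 8)) : -A = k + 1 - 2 * (J : ZMod 8) := by
  have h2 : n % 4 = 1 ∨ n % 4 = 3 := by rw [Nat.odd_iff] at hn; omega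
  rcases h2 with h2 | h2
  · rw [ZMod.χ₄_nat_one_mod_four h2] at hA
    have : (n : ZMod 8) = 1 ∨ (n : ZMod 8) = 5 := by
      rw [modcast]
      have : n % 8 = 1 ∨ n % 8 = 5 := by omega
      rcases this with e | e <;> rw [e] <;> decide
    rw [e] at this
    rcases hJ with rfl | rfl <;> rcases this with rfl | rfl <;> rw [hA] <;> decide
  · rw [ZMod.χ₄_nat_three_mod_four h2] at hA
    have : (n : ZMod 8) = 3 ∨ (n : ZMod 8) = 7 := by
      rw [modcast]
      have : n % 8 = 3 ∨ n % 8 = 7 := by omega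
      rcases this with e | e <;> rw [e] <;> decide
    rw [e] at this
    rcases hJ with rfl | rfl <;> rcases this with rfl | rfl <;> rw [hA] <;> decide

lemma main8 (k : ℕ) : ∀ h : ℤ, Odd k → IsCoprime h (k:ℤ) →
    (dA h k : ZMod 8) = k + 1 - 2 * (jacobiSym h k : ℤ) := by
  induction k using Nat.strong_induction_on with
  | _ k IH =>
  intro h hodd hc
  have hk := hodd.pos
  -- positive odd case
  have pos : ∀ a : ℕ, Odd a → a < k → IsCoprime (a:ℤ) (k:ℤ) →
      (dA a k : ZMod 8) = k + 1 - 2 * (jacobiSym a k : ℤ) := by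
    intro a ha hak hac
    exact step a k ha hodd (Nat.isCoprime_iff_coprime.1 hac) (IH a hak k ha hac.symm)
  by_cases k1 : k = 1
  · subst k1
    simp [dA, dF]
    decide
  have hk' : (0:ℤ) < k := by exact_mod_cast hk
  have b1 := Int.mul_ediv_add_emod h k
  have b2 := Int.emod_lt_of_pos h hk'
  have b3 := Int.emod_nonneg h hk'.ne'
  have hmod : jacobiSym h k = jacobiSym (h % k) k := jacobiSym.mod_left h k
  have hdA : dA h k = dA (h % k) k := by
    conv_lhs => rw [show h = h % k + (h / k) * k by linarith]
    exact dA_add _ _ _ hk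
  have hc' : IsCoprime (h % k) (k:ℤ) := by
    have : h % k = h + (-(h/k)) * k := by linarith
    rw [this]
    exact IsCoprime.add_mul_right_left hc _
  rw [hmod, hdA]
  generalize h % k = r at *
  obtain ⟨a, rfl⟩ := Int.eq_ofNat_of_zero_le b3
  rcases Nat.even_or_odd a with ev | od
  · have hlt : a < k := by omega
    have ha0 : a ≠ 0 := by
      rintro rfl
      have : IsUnit (k:ℤ) := isCoprime_zero_left.1 (by simpa using hc')
      rw [Int.isUnit_iff] at this; omega
    have hodd' : Odd (k - a) := Nat.Odd.sub_even hlt.le hodd ev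
    have e1 : ((k - a : ℕ) : ℤ) = -(a:ℤ) + 1 * k := by rw [Nat.cast_sub hlt.le]; ring
    have c1 : IsCoprime (((k-a : ℕ)) : ℤ) (k:ℤ) := by
      rw [e1]; exact IsCoprime.add_mul_right_left hc'.neg_left _
    have P := pos (k-a) hodd' (by omega) c1
    have j1 : jacobiSym ((k-a : ℕ):ℤ) k = ZMod.χ₄ k * jacobiSym a k := by
      rw [← jacobiSym.neg _ hodd]
      apply jacobiSym.mod_left'
      rw [e1]; simp
    rw [j1, e1, dA_add _ _ _ hk, dA_neg _ _ hk hc'] at P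
    have := key_neg k _ (jacobiSym a k) k hodd
      (jacobiSym.eq_one_or_neg_one (Int.isCoprime_iff_gcd_eq_one.1 hc')) rfl P
    simpa using this
  · exact pos a od (by omega) hc'

lemma ded_eq (h : ℤ) (k : ℕ) (hk : 0 < k) (hc : IsCoprime h (k:ℤ)) :
    12 * k * dedekindS h k = dA h k := by
  have hkq : (k:ℚ) ≠ 0 := by exact_mod_cast hk.ne'
  have hkz : (k:ℤ) ≠ 0 := by exact_mod_cast hk.ne'
  have hlast : sawtooth ((k:ℚ)/k) = 0 := by
    rw [div_self hkq]; simp [sawtooth]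
  have hset : Finset.Icc 1 k = insert k (Finset.Ico 1 k) := by
    ext; simp; omega
  have hrange : Finset.range k = insert 0 (Finset.Ico 1 k) := by
    ext; simp; omega
  have hterm : ∀ m ∈ Finset.Ico 1 k,
      sawtooth ((h * m : ℤ) / (k : ℚ)) * sawtooth ((m : ℚ) / (k : ℚ)) =
      (h/k^2) * ((m^2:ℤ):ℚ) - (h+1)/(2*k) * ((m:ℤ):ℚ) - 1/k * ((m * (h*m/k) : ℤ) : ℚ)
        + 1/2 * ((h*m/k : ℤ):ℚ) + 1/4 := by
    intro m hm
    rw [Finset.mem_Ico] at hm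
    have d1 : ¬ (((h * m : ℤ) : ℚ) / (k : ℚ)).den = 1 := by
      have := Rat.den_div_intCast_eq_one_iff (h*m) k hkz
      rw [Int.cast_natCast] at this
      rw [this]; exact ndvd h k m hc (by omega) hm.2
    have d2 : ¬ ((m : ℚ) / (k : ℚ)).den = 1 := by
      have := Rat.den_div_intCast_eq_one_iff m k hkz
      rw [Int.cast_natCast, Int.cast_natCast] at this
      rw [this]
      simpa using ndvd 1 k m isCoprime_one_left (by omega) hm.2
    have f2 : ⌊(m : ℚ) / (k : ℚ)⌋ = 0 := by
      rw [Int.floor_eq_zero_iff]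
      refine ⟨by positivity, ?_⟩
      rw [div_lt_one (by positivity)]
      exact_mod_cast hm.2
    unfold sawtooth
    rw [if_neg d1, if_neg d2, f2, Rat.floor_intCast_div_natCast]
    push_cast
    field_simp
    ring
  unfold dedekindS
  rw [hset, Finset.sum_insert (by simp), hlast, mul_zero, zero_add, Finset.sum_congr rfl hterm]
  have s1 := sum1 k
  have s2 := sum2 k
  have s3 := sum_f h k hk hc
  have s4 : dF h k = dF h k := rfl
  conv_rhs at s4 => unfold dF
  rw [hrange, Finset.sum_insert (by simp)] at s1 s2 s3 s4
  simp only [Finset.sum_add_distrib, Finset.sum_sub_distrib, ← Finset.mul_sum, ← Int.cast_sum]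
  simp only [Nat.cast_zero, mul_zero, Int.zero_ediv, zero_add, zero_mul, ne_eq, OfNat.ofNat_ne_zero, not_false_eq_true, zero_pow] at s1 s2 s3 s4
  rw [← s4]
  have q1 := congrArg (fun x : ℤ => (x : ℚ)) s1
  have q2 := congrArg (fun x : ℤ => (x : ℚ)) s2
  have q3 := congrArg (fun x : ℤ => (x : ℚ)) s3
  simp only [Int.cast_mul, Int.cast_sub, Int.cast_ofNat, Int.cast_natCast, Int.cast_one] at q1 q2 q3
  generalize ((∑ i ∈ Finset.Ico 1 k, (i:ℤ)^2 : ℤ) : ℚ) = S2 at *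
  generalize ((∑ i ∈ Finset.Ico 1 k, (i:ℤ) : ℤ) : ℚ) = S1 at *
  generalize ((∑ i ∈ Finset.Ico 1 k, (h * (i:ℤ) / k) : ℤ) : ℚ) = Sf at *
  have hcard : ∑ i ∈ Finset.Ico 1 k, (1/4:ℚ) = (k-1)/4 := by
    simp [Nat.cast_sub hk]; ring
  rw [hcard]
  unfold dA
  push_cast
  have e1 : S1 = k*(k-1)/2 := by linarith
  have e2 : S2 = k*(k-1)*(2*k-1)/6 := by linarith
  have e3 : Sf = (h-1)*(k-1)/2 := by linarith
  rw [e1, e2, e3]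
  field_simp
  ring

theorem stmt_10 (h : ℤ) (k : ℕ) (hk : 0 < k) (hodd : Odd k)
    (hcop : Int.gcd h k = 1) :
    ∃ n : ℤ, ((k : ℚ) - 1) / 2 - 6 * k * dedekindS h k = 2 * n ∧
      (jacobiSym h k : ℚ) = (-1 : ℚ) ^ n := by
  have hc : IsCoprime h (k:ℤ) := Int.isCoprime_iff_gcd_eq_one.2 hcop
  have E := ded_eq h k hk hc
  have M := main8 k h hodd hc
  have M' : ((dA h k : ℤ) : ZMod 8) = ((k + 1 - 2 * jacobiSym h k : ℤ) : ZMod 8) := by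
    push_cast; exact M
  have D := ((ZMod.intCast_eq_intCast_iff _ _ 8).1 M').dvd
  obtain ⟨c, hcc⟩ := D
  push_cast at hcc
  rcases jacobiSym.eq_one_or_neg_one hcop with j | j
  · refine ⟨2*c, ?_, ?_⟩
    · have : ((dA h k : ℤ):ℚ) = k + 1 - 2 - 8 * c := by
        rw [j] at hcc
        have : dA h k = k + 1 - 2 - 8*c := by linarith
        rw [this]; push_cast; ring
      push_cast
      linarith
    · rw [j, Even.neg_one_zpow ⟨c, by ring⟩]; simp
  · refine ⟨2*c-1, ?_, ?_⟩
    · have : ((dA h k : ℤ):ℚ) = k + 1 + 2 - 8 * c := by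
        rw [j] at hcc
        have : dA h k = k + 1 + 2 - 8*c := by linarith
        rw [this]; push_cast; ring
      push_cast
      linarith
    · rw [j, Odd.neg_one_zpow ⟨c-1, by ring⟩]; simp
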